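/- (Mean-value inequality for corrupted Gaussian KL) Let ε ∈ (0,1/2), m_a, m_b, m_* ∈ ℝ with Δ_a := m_* - m_a > Δ_min and Δ_b := m_* - m_b > Δ_min, where Δ_min = 2·Φ⁻¹(1/(2(1-ε))). Then kl^ε_G(m_a, m_*) - kl^ε_G(m_b, m_*) ≤ (1-ε)·max(m_b - m_a, 0)·max(Δ_a, Δ_b). -/

import Mathlib

open MeasureTheory ProbabilityTheory Real Set
open scoped ENNReal

noncomputable section

/-- Standard normal probability density function. -/
def stdphi (x : ℝ) : ℝ := (Real.sqrt (2 * Real.pi))⁻¹ * Real.exp (-x ^ 2 / 2)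

/-- Standard normal cumulative distribution function. -/
def stdPhi (x : ℝ) : ℝ := ((gaussianReal 0 1) (Set.Iic x)).toReal

/-- Standard normal quantile function. -/
def stdPhiInv (p : ℝ) : ℝ := sInf {x : ℝ | p ≤ stdPhi x}

/-- Minimum distinction gap under corruption, `Δ_min = 2 Φ⁻¹(1/(2(1-ε)))`. -/
def Dmin (ε : ℝ) : ℝ := 2 * stdPhiInv (1 / (2 * (1 - ε)))

/-- `ε`-corrupted mixture `(1-ε) μ + ε H` of two measures on `ℝ`. -/
def mix (ε : ℝ) (μ H : Measure ℝ) : Measure ℝ :=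
  ENNReal.ofReal (1 - ε) • μ + ENNReal.ofReal ε • H

open Classical in
/-- Kullback–Leibler divergence. -/
def KLdiv (P Q : Measure ℝ) : ℝ≥0∞ :=
  if P ≪ Q ∧ Integrable (fun x => Real.log (P.rnDeriv Q x).toReal) P then
    ENNReal.ofReal (∫ x, Real.log (P.rnDeriv Q x).toReal ∂P) else ⊤

/-- Corrupted Gaussian divergence `kl^ε_G(x, y)`: the infimum over pairs of corruption
distributions of the KL divergence between the corrupted unit-variance Gaussians. -/
def klG (ε x y : ℝ) : ℝ≥0∞ :=
  ⨅ (H : Measure ℝ) (_ : IsProbabilityMeasure H) (H' : Measure ℝ)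
    (_ : IsProbabilityMeasure H'),
    KLdiv (mix ε (gaussianReal x 1) H) (mix ε (gaussianReal y 1) H')

/-- (Lower) median of a probability measure on `ℝ`. -/
def measMed (μ : Measure ℝ) : ℝ := sInf {x : ℝ | 1 / 2 ≤ (μ (Set.Iic x)).toReal}

/-- Quantile function of a probability measure on `ℝ`. -/
def quantile (μ : Measure ℝ) (p : ℝ) : ℝ := sInf {x : ℝ | p ≤ (μ (Set.Iic x)).toReal}

/-- Empirical median of a finite sample. -/
def empMed {n : ℕ} (X : Fin n → ℝ) : ℝ :=
  sInf {x : ℝ | (n : ℝ) ≤ 2 * Nat.card {i : Fin n // X i ≤ x}}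

/-- The variance proxy `s_ε` for the concentration of the median under corruption. -/
def sEps (ε : ℝ) : ℝ :=
  (Real.sqrt (ε / 2 / Real.log (1 / (1 - 2 * ε))) +
      Real.sqrt ((1 - 2 * ε) / (4 * Real.log ((1 - ε) / ε)))) /
    ((1 - ε) * stdphi (Dmin ε / 2 + 1))

/-- Mean of a measure on `ℝ`. -/
def meanOf (μ : Measure ℝ) : ℝ := ∫ x, x ∂μ

/-- Corrupted KL-inf `KL^ε_inf(η, x; L)`. -/
def KLinf (ε : ℝ) (η : Measure ℝ) (x : ℝ) (L : Set (Measure ℝ)) : ℝ≥0∞ :=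
  ⨅ (κ : Measure ℝ) (_ : κ ∈ L) (_ : x ≤ meanOf κ) (H : Measure ℝ)
    (_ : IsProbabilityMeasure H) (H' : Measure ℝ) (_ : IsProbabilityMeasure H'),
    KLdiv (mix ε η H) (mix ε κ H')

open InformationTheory

lemma klDiv_mix_prod_le {α β : Type*} [MeasurableSpace α] [MeasurableSpace β]
    (A B : Measure α) [IsFiniteMeasure A] [IsFiniteMeasure B]
    (κ₀ κ₁ : Measure β) [IsProbabilityMeasure κ₀] [IsProbabilityMeasure κ₁] (hac : κ₀ ≪ κ₁) :
    klDiv (A.prod κ₀ + B.prod κ₁) ((A + B).prod κ₁) ≤ A univ * klDiv κ₀ κ₁ := by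
  set h := A.rnDeriv (A + B) with hh
  set k := B.rnDeriv (A + B) with hk
  set g := κ₀.rnDeriv κ₁ with hg
  have hA : A ≪ A + B := Measure.absolutelyContinuous_of_le (Measure.le_add_right le_rfl)
  have hB : B ≪ A + B := Measure.absolutelyContinuous_of_le (Measure.le_add_left le_rfl)
  have mh : Measurable h := Measure.measurable_rnDeriv _ _
  have mk : Measurable k := Measure.measurable_rnDeriv _ _
  have mg : Measurable g := Measure.measurable_rnDeriv _ _
  have eA : A = (A + B).withDensity h := (Measure.withDensity_rnDeriv_eq _ _ hA).symm
  have eB : B = (A + B).withDensity k := (Measure.withDensity_rnDeriv_eq _ _ hB).symm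
  have eκ : κ₀ = κ₁.withDensity g := (Measure.withDensity_rnDeriv_eq _ _ hac).symm
  have hsum : ∀ᵐ x ∂(A + B), h x + k x = 1 := by
    have h1 := Measure.rnDeriv_add A B (A + B)
    have h2 := Measure.rnDeriv_self (A + B)
    filter_upwards [h1, h2] with x h1 h2
    rw [← h2, h1]; rfl
  have eP : A.prod κ₀ + B.prod κ₁
      = ((A + B).prod κ₁).withDensity (fun z => h z.1 * g z.2 + k z.1) := by
    have hf : (fun z : α × β => h z.1 * g z.2 + k z.1)
        = (fun z : α × β => h z.1 * g z.2) + (fun z : α × β => k z.1) := by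
      ext z; simp only [Pi.add_apply]
    rw [hf, withDensity_add_left (by fun_prop)]
    congr 1
    · conv_lhs => rw [eA, eκ]
      exact prod_withDensity mh mg
    · conv_lhs => rw [eB]
      exact prod_withDensity_left mk
  have eAκ : A.prod κ₁ = ((A + B).prod κ₁).withDensity (fun z => h z.1) := by
    conv_lhs => rw [eA]
    exact prod_withDensity_left mh
  have hac' : A.prod κ₀ + B.prod κ₁ ≪ (A + B).prod κ₁ := by
    rw [eP]; exact withDensity_absolutelyContinuous _ _
  rw [klDiv_eq_lintegral_klFun_of_ac hac', klDiv_eq_lintegral_klFun_of_ac hac]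
  have hr : (A.prod κ₀ + B.prod κ₁).rnDeriv ((A + B).prod κ₁)
      =ᵐ[(A + B).prod κ₁] fun z => h z.1 * g z.2 + k z.1 := by
    rw [eP]; exact Measure.rnDeriv_withDensity _ (by fun_prop)
  have hsum' : ∀ᵐ z ∂((A + B).prod κ₁), h z.1 + k z.1 = 1 :=
    Measure.quasiMeasurePreserving_fst.ae hsum
  have hgt : ∀ᵐ z ∂((A + B).prod κ₁), g z.2 < ∞ :=
    Measure.quasiMeasurePreserving_snd.ae (Measure.rnDeriv_lt_top κ₀ κ₁)
  calc ∫⁻ z, ENNReal.ofReal (klFun ((A.prod κ₀ + B.prod κ₁).rnDeriv ((A + B).prod κ₁) z).toReal)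
        ∂((A + B).prod κ₁)
      ≤ ∫⁻ z, h z.1 * ENNReal.ofReal (klFun (g z.2).toReal) ∂((A + B).prod κ₁) := by
        refine lintegral_mono_ae ?_
        filter_upwards [hr, hsum', hgt] with z hr hs hgt
        rw [hr]
        have h1 : h z.1 ≠ ∞ := by
          intro hc; rw [hc] at hs; simp at hs
        have k1 : k z.1 ≠ ∞ := by
          intro hc; rw [hc] at hs; simp at hs
        have hs' : (h z.1).toReal + (k z.1).toReal = 1 := by
          rw [← ENNReal.toReal_add h1 k1, hs]; simp
        rw [ENNReal.toReal_add (ENNReal.mul_ne_top h1 hgt.ne) k1, ENNReal.toReal_mul]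
        have hc := convexOn_klFun.2 (x := (g z.2).toReal) ENNReal.toReal_nonneg
          (y := 1) (by simp) (ENNReal.toReal_nonneg (a := h z.1))
          (ENNReal.toReal_nonneg (a := k z.1)) hs'
        simp only [smul_eq_mul, klFun_one, mul_zero, add_zero, mul_one] at hc
        refine (ENNReal.ofReal_le_ofReal hc).trans ?_
        rw [ENNReal.ofReal_mul ENNReal.toReal_nonneg, ENNReal.ofReal_toReal h1]
    _ = ∫⁻ z, ENNReal.ofReal (klFun (g z.2).toReal) ∂(A.prod κ₁) := by
        rw [eAκ, lintegral_withDensity_eq_lintegral_mul _ (by fun_prop) (by fun_prop)]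
        rfl
    _ = A univ * ∫⁻ y, ENNReal.ofReal (klFun (g y).toReal) ∂κ₁ := by
        rw [lintegral_prod _ (by fun_prop)]
        simp [mul_comm]

lemma gauss_wd (δ : ℝ) : gaussianReal 0 1 =
    (gaussianReal δ 1).withDensity (fun y => ENNReal.ofReal (rexp (-δ * y + δ ^ 2 / 2))) := by
  rw [gaussianReal_of_var_ne_zero _ one_ne_zero, gaussianReal_of_var_ne_zero _ one_ne_zero,
    ← withDensity_mul _ (by fun_prop) (by fun_prop)]
  congr 1
  ext y
  simp only [gaussianPDF, Pi.mul_apply]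
  rw [← ENNReal.ofReal_mul (gaussianPDFReal_nonneg _ _ _)]
  congr 1
  simp only [gaussianPDFReal]
  rw [mul_assoc (√(2 * π * ((1 : NNReal) : ℝ)))⁻¹, ← Real.exp_add]
  congr 2
  simp
  ring

lemma gauss_kl (δ : ℝ) :
    klDiv (gaussianReal 0 1) (gaussianReal δ 1) = ENNReal.ofReal (δ ^ 2 / 2) := by
  have hac : gaussianReal 0 1 ≪ gaussianReal δ 1 := by
    conv_lhs => rw [gauss_wd δ]
    exact withDensity_absolutelyContinuous _ _
  have hl : llr (gaussianReal 0 1) (gaussianReal δ 1) =ᵐ[gaussianReal 0 1]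
      fun y => -δ * y + δ ^ 2 / 2 := by
    apply hac.ae_le
    have := Measure.rnDeriv_withDensity (gaussianReal δ 1)
      (f := fun y => ENNReal.ofReal (rexp (-δ * y + δ ^ 2 / 2))) (by fun_prop)
    rw [← gauss_wd δ] at this
    filter_upwards [this] with y hy
    rw [llr, hy, ENNReal.toReal_ofReal (exp_pos _).le, Real.log_exp]
  have hid : Integrable (fun y : ℝ => y) (gaussianReal 0 1) :=
    (memLp_id_gaussianReal 1).integrable (by simp)
  have hint : Integrable (fun y : ℝ => -δ * y + δ ^ 2 / 2) (gaussianReal 0 1) :=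
    (hid.const_mul _).add (integrable_const _)
  rw [klDiv_of_ac_of_integrable hac ((integrable_congr hl).2 hint), integral_congr_ae hl,
    integral_add (hid.const_mul _) (integrable_const _), integral_const_mul]
  simp

lemma KLdiv_eq (P Q : Measure ℝ) [IsProbabilityMeasure P] [IsProbabilityMeasure Q] :
    KLdiv P Q = klDiv P Q := by
  rw [klDiv_def]
  unfold KLdiv
  simp only [llr_def]
  simp only [probReal_univ, add_sub_cancel_right]
  congr

lemma mix_prob (ε : ℝ) (hε : ε ∈ Set.Ioo (0 : ℝ) (1 / 2)) (P Q : Measure ℝ)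
    [IsProbabilityMeasure P] [IsProbabilityMeasure Q] : IsProbabilityMeasure (mix ε P Q) := by
  constructor
  simp only [mix, Measure.coe_add, Measure.coe_smul, Pi.add_apply, Pi.smul_apply, measure_univ,
    smul_eq_mul, mul_one]
  rw [← ENNReal.ofReal_add (by linarith [hε.2]) hε.1.le]
  simp

lemma gauss_push (m d μ α β : ℝ) (hαβ : α ^ 2 + β ^ 2 = 1) :
    ((gaussianReal m 1).prod (gaussianReal d 1)).map (fun z : ℝ × ℝ => α * z.1 + β * z.2 + μ)
      = gaussianReal (α * m + β * d + μ) 1 := by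
  have h1 : (fun z : ℝ × ℝ => α * z.1 + β * z.2 + μ) =
    (fun x => x + μ) ∘ (fun z : ℝ × ℝ => z.1 + z.2) ∘ (Prod.map (fun x => α * x) (fun x => β * x)) := by
    ext z; simp
  rw [h1, ← Measure.map_map (by fun_prop) (by fun_prop),
    ← Measure.map_map (by fun_prop) (by fun_prop),
    ← Measure.map_prod_map _ _ (by fun_prop) (by fun_prop), gaussianReal_map_const_mul,
    gaussianReal_map_const_mul]
  have := gaussianReal_conv_gaussianReal (m₁ := α * m) (m₂ := β * d)
    (v₁ := .mk (α ^ 2) (sq_nonneg _) * 1) (v₂ := .mk (β ^ 2) (sq_nonneg _) * 1)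
  rw [Measure.conv] at this
  rw [this, gaussianReal_map_add_const]
  congr 1
  ext
  simpa using hαβ

lemma klG_le (ε mA mB mS α β δ : ℝ) (hε : ε ∈ Set.Ioo (0 : ℝ) (1 / 2))
    (hαβ : α ^ 2 + β ^ 2 = 1) (hδ : α * (mS - mB) + β * δ = mS - mA) :
    klG ε mA mS ≤ klG ε mB mS + ENNReal.ofReal ((1 - ε) * (δ ^ 2 / 2)) := by
  conv_rhs => rw [klG]
  simp only [ENNReal.iInf_add]
  refine le_iInf fun H => le_iInf fun iH => le_iInf fun H' => le_iInf fun iH' => ?_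
  let T : ℝ × ℝ → ℝ := fun z => α * z.1 + β * z.2 + (mA - α * mB)
  have mT : Measurable T := by fun_prop
  have mix_map : ∀ m d : ℝ, ∀ K : Measure (ℝ × ℝ),
      (ENNReal.ofReal (1 - ε) • (gaussianReal m 1).prod (gaussianReal d 1)
        + ENNReal.ofReal ε • K).map T
      = mix ε (gaussianReal (α * m + β * d + (mA - α * mB)) 1) (K.map T) := by
    intro m d K
    rw [Measure.map_add _ _ mT, Measure.map_smul, Measure.map_smul, mix, gauss_push _ _ _ _ _ hαβ]
  set N := gaussianReal δ 1 with hN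
  set P := mix ε (gaussianReal mB 1) H with hP
  set Q := mix ε (gaussianReal mS 1) H' with hQ
  have iP : IsProbabilityMeasure P := mix_prob ε hε _ _
  have iQ : IsProbabilityMeasure Q := mix_prob ε hε _ _
  set A := ENNReal.ofReal (1 - ε) • gaussianReal mB 1 with hA
  set B := ENNReal.ofReal ε • H with hB
  have fA : IsFiniteMeasure A := Measure.smul_finite _ ENNReal.ofReal_ne_top
  have fB : IsFiniteMeasure B := Measure.smul_finite _ ENNReal.ofReal_ne_top
  set P' := A.prod (gaussianReal 0 1) + B.prod N with hP'
  have hPAB : P = A + B := rfl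
  have hfst : P'.fst = P := by
    rw [hP', Measure.fst_add, Measure.fst_prod, Measure.fst_prod, hPAB]
  have iP' : IsProbabilityMeasure P' := by
    constructor
    rw [← Measure.fst_univ, hfst]; simp
  have hdis : P' = P ⊗ₘ P'.condKernel := by
    conv_rhs => rw [← hfst]
    exact P'.disintegrate P'.condKernel |>.symm
  have hchain : klDiv P' (Q.prod N) = klDiv P Q + klDiv P' (P.prod N) := by
    rw [← Measure.compProd_const, ← Measure.compProd_const]
    conv_lhs => rw [hdis]
    rw [klDiv_compProd_eq_add, ← hdis]
  have hmix : klDiv P' (P.prod N) ≤ ENNReal.ofReal ((1 - ε) * (δ ^ 2 / 2)) := by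
    have hac : gaussianReal 0 1 ≪ N := by
      conv_lhs => rw [gauss_wd δ]
      exact withDensity_absolutelyContinuous _ _
    refine (klDiv_mix_prod_le A B (gaussianReal 0 1) N hac).trans ?_
    rw [hN, gauss_kl, ENNReal.ofReal_mul (by linarith [hε.2])]
    simp [hA]
  have e1 : P'.map T = mix ε (gaussianReal mA 1) ((H.prod N).map T) := by
    rw [hP', hA, hB, Measure.prod_smul_left, Measure.prod_smul_left, mix_map]
    congr 2; ring
  have e2 : (Q.prod N).map T = mix ε (gaussianReal mS 1) ((H'.prod N).map T) := by
    rw [hQ, mix, Measure.add_prod, Measure.prod_smul_left, Measure.prod_smul_left, mix_map]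
    congr 2; linarith
  have i1 : IsProbabilityMeasure ((H.prod N).map T) :=
    Measure.isProbabilityMeasure_map mT.aemeasurable
  have i2 : IsProbabilityMeasure ((H'.prod N).map T) :=
    Measure.isProbabilityMeasure_map mT.aemeasurable
  have j1 := mix_prob ε hε (gaussianReal mA 1) ((H.prod N).map T)
  have j2 := mix_prob ε hε (gaussianReal mS 1) ((H'.prod N).map T)
  calc klG ε mA mS ≤ KLdiv (mix ε (gaussianReal mA 1) ((H.prod N).map T))
        (mix ε (gaussianReal mS 1) ((H'.prod N).map T)) := by
        rw [klG]
        exact (iInf₂_le _ i1).trans (iInf₂_le _ i2)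
    _ ≤ klDiv P' (Q.prod N) := by
        rw [KLdiv_eq, ← e1, ← e2]
        exact klDiv_map_le _ _ mT
    _ ≤ _ := by
        rw [hchain, KLdiv_eq]
        gcongr

lemma klG_self (ε m : ℝ) (hε : ε ∈ Set.Ioo (0 : ℝ) (1 / 2)) : klG ε m m = 0 := by
  have i := mix_prob ε hε (gaussianReal m 1) (gaussianReal m 1)
  refine le_antisymm ?_ zero_le
  rw [klG]
  have j : IsProbabilityMeasure (gaussianReal m 1) := inferInstance
  refine (iInf₂_le (gaussianReal m 1) j).trans ((iInf₂_le (gaussianReal m 1) j).trans ?_)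
  rw [KLdiv_eq, klDiv_self]

lemma klG_ne_top (ε x y : ℝ) (hε : ε ∈ Set.Ioo (0 : ℝ) (1 / 2)) : klG ε x y ≠ ∞ := by
  have := klG_le ε x y y 0 1 (y - x) hε (by norm_num) (by ring)
  rw [klG_self ε y hε] at this
  exact ne_top_of_le_ne_top (by simp) this

lemma stdPhi_neg {x : ℝ} (hx : x < 0) : stdPhi x ≤ 1 / 2 := by
  have h1 : gaussianReal 0 1 (Iic x) = gaussianReal 0 1 (Ici (-x)) := by
    have := gaussianReal_map_neg (μ := 0) (v := 1)
    rw [neg_zero] at this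
    conv_lhs => rw [← this]
    rw [Measure.map_apply (by fun_prop) measurableSet_Iic]
    congr 1
    ext y; simp
  have h2 : (gaussianReal 0 1).real (Iic x ∪ Ici (-x)) ≤ 1 := measureReal_le_one
  rw [measureReal_union (by
    rw [Set.disjoint_left]; intro y hy hy'
    simp only [mem_Iic, mem_Ici] at hy hy'; linarith) measurableSet_Ici] at h2
  simp only [measureReal_def, ← h1] at h2
  unfold stdPhi
  linarith

lemma Dmin_nonneg (ε : ℝ) (hε : ε ∈ Set.Ioo (0 : ℝ) (1 / 2)) : 0 ≤ Dmin ε := by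
  unfold Dmin stdPhiInv
  refine mul_nonneg (by norm_num) (Real.sInf_nonneg ?_)
  intro x hx
  by_contra! hneg
  have h1 := stdPhi_neg hneg
  have h2 : (1 : ℝ) / 2 < 1 / (2 * (1 - ε)) := by
    apply one_div_lt_one_div_of_lt <;> linarith [hε.1, hε.2]
  have h3 : 1 / (2 * (1 - ε)) ≤ stdPhi x := hx
  linarith

/-- mean-value inequality for the corrupted Gaussian divergence. -/
theorem klG_mean_value_inequality (ε mA mB mStar : ℝ) (hε : ε ∈ Set.Ioo (0 : ℝ) (1 / 2))
    (hΔa : Dmin ε < mStar - mA) (hΔb : Dmin ε < mStar - mB) :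
    (klG ε mA mStar).toReal - (klG ε mB mStar).toReal ≤
      (1 - ε) * max (mB - mA) 0 * max (mStar - mA) (mStar - mB) := by
  have hD := Dmin_nonneg ε hε
  have ha : 0 < mStar - mA := by linarith
  have hb : 0 < mStar - mB := by linarith
  have key : ∀ α β δ : ℝ, α ^ 2 + β ^ 2 = 1 → α * (mStar - mB) + β * δ = mStar - mA →
      (klG ε mA mStar).toReal - (klG ε mB mStar).toReal ≤ (1 - ε) * (δ ^ 2 / 2) := by
    intro α β δ h1 h2
    have h := klG_le ε mA mB mStar α β δ hε h1 h2
    have h0 : 0 ≤ (1 - ε) * (δ ^ 2 / 2) := mul_nonneg (by linarith [hε.2]) (by positivity)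
    have h' := ENNReal.toReal_mono (ENNReal.add_ne_top.2 ⟨klG_ne_top ε mB mStar hε,
      ENNReal.ofReal_ne_top⟩) h
    rw [ENNReal.toReal_add (klG_ne_top ε mB mStar hε) ENNReal.ofReal_ne_top,
      ENNReal.toReal_ofReal h0] at h'
    linarith
  rcases le_total mA mB with hle | hle
  · have hsq : 0 ≤ (mStar - mA) ^ 2 - (mStar - mB) ^ 2 := by nlinarith
    have hs := Real.sq_sqrt hsq
    set δ := √((mStar - mA) ^ 2 - (mStar - mB) ^ 2)
    refine (key ((mStar - mB) / (mStar - mA)) (δ / (mStar - mA)) δ ?_ ?_).trans ?_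
    · field_simp
      rw [hs]; ring
    · field_simp
      rw [hs]; ring
    · rw [hs, max_eq_left (by linarith), max_eq_left (by linarith), mul_assoc]
      refine mul_le_mul_of_nonneg_left ?_ (by linarith [hε.2])
      nlinarith
  · have hsq : 0 ≤ 1 - ((mStar - mA) / (mStar - mB)) ^ 2 := by
      rw [sub_nonneg, div_pow, div_le_one (by positivity)]
      nlinarith
    have hs := Real.sq_sqrt hsq
    refine (key ((mStar - mA) / (mStar - mB)) (√(1 - ((mStar - mA) / (mStar - mB)) ^ 2)) 0
      ?_ ?_).trans ?_
    · rw [hs]; ring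
    · field_simp
      ring
    · rw [max_eq_right (b := (0 : ℝ)) (by linarith)]
      simp
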